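/- Let G=(V,E) be a graph and S ⊂ V. Then there exists a (|S|², 2)-sparsifier for S in G: a multigraph H on vertex set S such that every fractional multicommodity flow in G with all endpoints in S can be fractionally routed in H with congestion at most |S|², and every integral multicommodity flow in H can be integrally routed in G (as edge-disjoint-with-congestion paths) with congestion at most 2. -/

import Mathlib

open Finset

/-- Count of occurrences of `e` in a list (classical, no decidability assumptions). -/
noncomputable def ecount {α : Type} (l : List α) (e : α) : ℕ :=
  letI := Classical.decEq α
  l.count e

section Cuts

variable {V : Type} [DecidableEq V]

/-- `1` if exactly one endpoint of `e` lies in `X`, and `0` otherwise. -/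
def cutIndicator (X : Finset V) : Sym2 V → ℕ :=
  Sym2.lift ⟨fun a b => if (a ∈ X ↔ b ∈ X) then 0 else 1, fun a b => by
    simp only [iff_comm]⟩

/-- The number of edges of the multigraph `E` with exactly one endpoint in `X`. -/
def cutSize (E : Multiset (Sym2 V)) (X : Finset V) : ℕ :=
  (E.map (cutIndicator X)).sum

lemma cutIndicator_mk (X : Finset V) (a b : V) :
    cutIndicator X s(a, b) = if (a ∈ X ↔ b ∈ X) then 0 else 1 := rfl

@[simp] lemma cutSize_cons (e : Sym2 V) (E : Multiset (Sym2 V)) (X : Finset V) :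
    cutSize (e ::ₘ E) X = cutIndicator X e + cutSize E X := by
  simp [cutSize]

lemma cutSize_add (E F : Multiset (Sym2 V)) (X : Finset V) :
    cutSize (E + F) X = cutSize E X + cutSize F X := by
  simp [cutSize]

lemma cutIndicator_le_one (X : Finset V) (e : Sym2 V) : cutIndicator X e ≤ 1 := by
  induction e with
  | _ a b => rw [cutIndicator_mk]; split_ifs <;> simp

lemma cutSize_le_card (E : Multiset (Sym2 V)) (X : Finset V) :
    cutSize E X ≤ Multiset.card E := by
  induction E using Multiset.induction_on with
  | empty => simp [cutSize]
  | cons e E ih =>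
    have := cutIndicator_le_one X e
    simp only [cutSize_cons, Multiset.card_cons]
    omega

lemma cutSize_compl [Fintype V] (E : Multiset (Sym2 V)) (X : Finset V) :
    cutSize E Xᶜ = cutSize E X := by
  unfold cutSize
  congr 1
  refine Multiset.map_congr rfl fun e _ => ?_
  induction e with
  | _ a b => simp only [cutIndicator_mk, Finset.mem_compl, not_iff_not]

lemma cutSize_inter_add_union_le (E : Multiset (Sym2 V)) (X Y : Finset V) :
    cutSize E (X ∩ Y) + cutSize E (X ∪ Y) ≤ cutSize E X + cutSize E Y := by
  unfold cutSize
  rw [← Multiset.sum_map_add, ← Multiset.sum_map_add]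
  refine Multiset.sum_map_le_sum_map _ _ fun e _ => ?_
  induction e with
  | _ a b =>
    simp only [cutIndicator_mk, Finset.mem_inter, Finset.mem_union]
    by_cases a ∈ X <;> by_cases a ∈ Y <;> by_cases b ∈ X <;> by_cases b ∈ Y <;> simp [*]

lemma cutSize_sdiff_add_sdiff_le (E : Multiset (Sym2 V)) (X Y : Finset V) :
    cutSize E (X \ Y) + cutSize E (Y \ X) ≤ cutSize E X + cutSize E Y := by
  unfold cutSize
  rw [← Multiset.sum_map_add, ← Multiset.sum_map_add]
  refine Multiset.sum_map_le_sum_map _ _ fun e _ => ?_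
  induction e with
  | _ a b =>
    simp only [cutIndicator_mk, Finset.mem_sdiff]
    by_cases a ∈ X <;> by_cases a ∈ Y <;> by_cases b ∈ X <;> by_cases b ∈ Y <;> simp [*]

/-- Every cut of `E` separating two terminals `s, t ∈ T` has size at least `r s t`. -/
def MeetsRequirement (T : Finset V) (r : V → V → ℕ) (E : Multiset (Sym2 V)) : Prop :=
  ∀ X : Finset V, ∀ s ∈ T, ∀ t ∈ T, (s ∈ X ↔ t ∉ X) → r s t ≤ cutSize E X

/-- The cut `X` separates two terminals whose requirement it meets with equality. -/
def IsTightCut (T : Finset V) (r : V → V → ℕ) (E : Multiset (Sym2 V)) (X : Finset V) : Prop :=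
  ∃ s ∈ T, ∃ t ∈ T, (s ∈ X ↔ t ∉ X) ∧ cutSize E X ≤ r s t

set_option maxHeartbeats 2000000 in
/-- Two crossing tight cuts have a tight union, if some edge joins their intersection to the
complement of their union. -/
lemma IsTightCut.union {T : Finset V} {r : V → V → ℕ} {E : Multiset (Sym2 V)} {X Y : Finset V}
    (hE : MeetsRequirement T r E) (hX : IsTightCut T r E X) (hY : IsTightCut T r E Y)
    {z u : V} (hzu : s(z, u) ∈ E) (hzX : z ∉ X) (hzY : z ∉ Y) (huX : u ∈ X) (huY : u ∈ Y) :
    IsTightCut T r E (X ∪ Y) := by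
  obtain ⟨s, hs, t, ht, hst, h1⟩ := hX
  obtain ⟨p, hp, q, hq, hpq, h2⟩ := hY
  by_contra hcon
  have hsub := cutSize_inter_add_union_le E X Y
  have hpos : cutSize E (X \ Y) + cutSize E (Y \ X) + 2 ≤ cutSize E X + cutSize E Y := by
    obtain ⟨E', rfl⟩ := Multiset.exists_cons_of_mem hzu
    have := cutSize_sdiff_add_sdiff_le E' X Y
    simp only [cutSize_cons, cutIndicator_mk, Finset.mem_sdiff]
    simp only [hzX, hzY, huX, huY]
    simp
    omega
  have c1 := fun h => not_le.1 fun h' => hcon ⟨s, hs, t, ht, h, h'⟩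
  have c2 := fun h => not_le.1 fun h' => hcon ⟨p, hp, q, hq, h, h'⟩
  have a1 := hE (X ∩ Y) s hs t ht
  have a2 := hE (X ∩ Y) p hp q hq
  have b1 := hE (X \ Y) s hs t ht
  have b2 := hE (X \ Y) p hp q hq
  have d1 := hE (Y \ X) s hs t ht
  have d2 := hE (Y \ X) p hp q hq
  have e1 := hE (X ∪ Y) s hs t ht
  have e2 := hE (X ∪ Y) p hp q hq
  simp only [Finset.mem_inter, Finset.mem_union, Finset.mem_sdiff] at *
  clear hcon hE hs ht hp hq hzu hzX hzY huX huY
  generalize cutSize E (X ∩ Y) = A at *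
  generalize cutSize E (X ∪ Y) = B at *
  generalize cutSize E (X \ Y) = C at *
  generalize cutSize E (Y \ X) = D at *
  generalize cutSize E X = F at *
  generalize cutSize E Y = H at *
  generalize r s t = r1 at *
  generalize r p q = r2 at *
  by_cases k1 : s ∈ X <;> by_cases k2 : t ∈ X <;> simp only [k1, k2] at hst <;>
  by_cases k3 : p ∈ Y <;> by_cases k4 : q ∈ Y <;> simp only [k3, k4] at hpq <;>
  by_cases k5 : s ∈ Y <;> by_cases k6 : t ∈ Y <;>
  by_cases k7 : p ∈ X <;> by_cases k8 : q ∈ X <;>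
  simp [k1, k2, k3, k4, k5, k6, k7, k8] at * <;> omega

/-- If splitting off `zu, zv` violates a requirement in an Eulerian multigraph, then some tight cut
contains `u` and `v` but not `z`. -/
lemma exists_isTightCut_of_not_meetsRequirement [Fintype V] {T : Finset V} {r : V → V → ℕ}
    (hr : ∀ s t, Even (r s t)) {E : Multiset (Sym2 V)} {z u v : V}
    (heven : ∀ X, Even (cutSize (s(z, u) ::ₘ s(z, v) ::ₘ E) X))
    (hE : MeetsRequirement T r (s(z, u) ::ₘ s(z, v) ::ₘ E))
    (hnot : ¬ MeetsRequirement T r (s(u, v) ::ₘ E)) :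
    ∃ X, IsTightCut T r (s(z, u) ::ₘ s(z, v) ::ₘ E) X ∧ z ∉ X ∧ u ∈ X ∧ v ∈ X := by
  unfold MeetsRequirement at hnot
  push Not at hnot
  obtain ⟨X, s, hs, t, ht, hst, hlt⟩ := hnot
  have h1 := hE X s hs t ht hst
  have h2 := heven X
  have h3 := hr s t
  have key : cutSize (s(z, u) ::ₘ s(z, v) ::ₘ E) X ≤ r s t ∧ (z ∈ X ↔ u ∉ X) ∧ (z ∈ X ↔ v ∉ X) := by
    simp only [cutSize_cons, cutIndicator_mk] at *
    rw [Nat.even_iff] at h2 h3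
    by_cases k1 : z ∈ X <;> by_cases k2 : u ∈ X <;> by_cases k3 : v ∈ X <;>
      simp [k1, k2, k3] at * <;> omega
  obtain ⟨k1, k2, k3⟩ := key
  by_cases hz : z ∈ X
  · refine ⟨Xᶜ, ⟨s, hs, t, ht, ?_, ?_⟩, ?_⟩
    · simp only [Finset.mem_compl]; tauto
    · rwa [cutSize_compl]
    · simp only [Finset.mem_compl]; tauto
  · exact ⟨X, ⟨s, hs, t, ht, hst, k1⟩, hz, by tauto, by tauto⟩

/-- **Splitting off** in Eulerian multigraphs: every edge at a non-terminal `z` can be split off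
together with another edge at `z`, preserving the requirements between terminals. -/
lemma exists_splitting [Fintype V] {T : Finset V} {r : V → V → ℕ}
    (hr : ∀ s t, Even (r s t)) {E : Multiset (Sym2 V)} {z u : V}
    (heven : ∀ X, Even (cutSize E X)) (hE : MeetsRequirement T r E)
    (hz : z ∉ T) (hzu : z ≠ u) (hmem : s(z, u) ∈ E) :
    ∃ v E', E = s(z, u) ::ₘ s(z, v) ::ₘ E' ∧ MeetsRequirement T r (s(u, v) ::ₘ E') := by
  by_contra hcon
  push Not at hcon
  obtain ⟨F, rfl⟩ := Multiset.exists_cons_of_mem hmem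
  have htight : ∀ v, s(z, v) ∈ F →
      ∃ X, IsTightCut T r (s(z, u) ::ₘ F) X ∧ z ∉ X ∧ u ∈ X ∧ v ∈ X := by
    intro v hv
    obtain ⟨E', rfl⟩ := Multiset.exists_cons_of_mem hv
    exact exists_isTightCut_of_not_meetsRequirement hr heven hE (hcon v E' rfl)
  obtain ⟨w, hw⟩ : ∃ w, s(z, w) ∈ F := by
    by_contra hno
    push Not at hno
    have h0 : cutSize F {z} = 0 := by
      unfold cutSize
      refine Multiset.sum_eq_zero fun n hn => ?_
      obtain ⟨e, he, rfl⟩ := Multiset.mem_map.1 hn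
      induction e with
      | _ a b =>
        have ha : a ≠ z := fun h => hno b (h ▸ he)
        have hb : b ≠ z := fun h => hno a (by rw [← h, Sym2.eq_swap]; exact he)
        simp [cutIndicator_mk, ha, hb]
    have h1 := heven {z}
    rw [cutSize_cons, h0, cutIndicator_mk] at h1
    simp [hzu.symm] at h1
  classical
  obtain ⟨X₀, hX₀, hzX₀, huX₀, -⟩ := htight w hw
  obtain ⟨X, hX, hmax⟩ := Finset.exists_max_image
    (Finset.univ.filter fun X => IsTightCut T r (s(z, u) ::ₘ F) X ∧ z ∉ X ∧ u ∈ X)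
    Finset.card ⟨X₀, by simp [hX₀, hzX₀, huX₀]⟩
  simp only [Finset.mem_filter, Finset.mem_univ, true_and] at hX hmax
  obtain ⟨hXt, hzX, huX⟩ := hX
  by_cases hall : ∀ v, s(z, v) ∈ F → v ∈ X
  · obtain ⟨s, hs, t, ht, hst, hle⟩ := hXt
    have hsz : s ≠ z := fun h => hz (h ▸ hs)
    have htz : t ≠ z := fun h => hz (h ▸ ht)
    have h1 := hE (insert z X) s hs t ht (by simpa [hsz, htz] using hst)
    have h2 : cutSize F (insert z X) ≤ cutSize F X := by
      unfold cutSize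
      refine Multiset.sum_map_le_sum_map _ _ fun e he => ?_
      induction e with
      | _ a b =>
        simp only [cutIndicator_mk, Finset.mem_insert]
        by_cases ha : a = z
        · subst ha
          simp [hall b he]
        · by_cases hb : b = z
          · subst hb
            simp [hall a (by rw [Sym2.eq_swap]; exact he)]
          · simp [ha, hb]
    simp only [cutSize_cons, cutIndicator_mk] at h1 hle
    simp [hzX, huX] at h1 hle
    omega
  · push Not at hall
    obtain ⟨v, hv, hvX⟩ := hall
    obtain ⟨Y, hY, hzY, huY, hvY⟩ := htight v hv
    have hU := hXt.union hE hY hmem hzX hzY huX huY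
    have := hmax (X ∪ Y) ⟨hU, by simp [hzX, hzY], by simp [huX]⟩
    have hlt : X.card < (X ∪ Y).card :=
      Finset.card_lt_card ⟨Finset.subset_union_left,
        fun h => hvX (h (Finset.mem_union_right _ hvY))⟩
    omega

end Cuts

section EdgeCount

@[simp] lemma ecount_nil {α : Type} (e : α) : ecount [] e = 0 := by
  simp [ecount]

lemma ecount_append {α : Type} (l l' : List α) (e : α) :
    ecount (l ++ l') e = ecount l e + ecount l' e := by
  simp [ecount]

lemma ecount_reverse {α : Type} (l : List α) (e : α) : ecount l.reverse e = ecount l e := by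
  simp [ecount]

lemma ecount_cons {α : Type} (a : α) (l : List α) (e : α) :
    ecount (a :: l) e = ecount [a] e + ecount l e :=
  ecount_append [a] l e

lemma ecount_singleton {α : Type} [DecidableEq α] (a e : α) :
    ecount [a] e = if a = e then 1 else 0 := by
  simp only [ecount, List.count_singleton, beq_iff_eq]

lemma one_le_ecount {α : Type} {l : List α} {e : α} (h : e ∈ l) : 1 ≤ ecount l e := by
  classical
  simp only [ecount]
  exact List.one_le_count_iff.2 h

end EdgeCount

section WalkFamilies

variable {V : Type} {G : SimpleGraph V}

/-- A walk bundled with its endpoints, viewed as an edge between them. -/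
abbrev BundledWalk (G : SimpleGraph V) : Type := Σ u v : V, G.Walk u v

/-- The unordered pair of endpoints. -/
def BundledWalk.ends (x : BundledWalk G) : Sym2 V := s(x.1, x.2.1)

/-- The multiplicity with which a walk traverses an edge. -/
noncomputable def BundledWalk.mult (e : Sym2 V) (x : BundledWalk G) : ℕ := ecount x.2.2.edges e

/-- The multiplicity with which a family of walks traverses an edge. -/
noncomputable def load (L : Multiset (BundledWalk G)) (e : Sym2 V) : ℕ :=
  (L.map (BundledWalk.mult e)).sum

@[simp] lemma load_zero (e : Sym2 V) : load (0 : Multiset (BundledWalk G)) e = 0 := by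
  simp [load]

@[simp] lemma load_cons (x : BundledWalk G) (L : Multiset (BundledWalk G)) (e : Sym2 V) :
    load (x ::ₘ L) e = x.mult e + load L e := by
  simp [load]

lemma BundledWalk.exists_walk (x : BundledWalk G) {a b : V} (h : x.ends = s(a, b)) :
    ∃ p : G.Walk a b, ∀ e, ecount p.edges e = x.mult e := by
  obtain ⟨u, v, p⟩ := x
  rcases Sym2.eq_iff.1 h with ⟨h1, h2⟩ | ⟨h1, h2⟩
  · dsimp only at h1 h2
    subst h1 h2
    exact ⟨p, fun e => rfl⟩
  · dsimp only at h1 h2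
    subst h1 h2
    exact ⟨p.reverse, fun e => by
      rw [SimpleGraph.Walk.edges_reverse, ecount_reverse]; rfl⟩

lemma exists_bundledWalks_of_edges [DecidableEq V] (F : Multiset (Sym2 V))
    (hF : ∀ e ∈ F, e ∈ G.edgeSet) :
    ∃ L : Multiset (BundledWalk G), L.map BundledWalk.ends = F ∧ ∀ e, load L e = F.count e := by
  induction F using Multiset.induction_on with
  | empty => exact ⟨0, by simp⟩
  | cons f F ih =>
    obtain ⟨L, h1, h2⟩ := ih fun e he => hF e (Multiset.mem_cons_of_mem he)
    have hf := hF f (Multiset.mem_cons_self f F)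
    induction f with
    | _ a b =>
      rw [SimpleGraph.mem_edgeSet] at hf
      refine ⟨⟨a, b, hf.toWalk⟩ ::ₘ L, ?_, fun e => ?_⟩
      · rw [Multiset.map_cons, h1]; rfl
      · rw [load_cons, h2, Multiset.count_cons]
        simp only [BundledWalk.mult, SimpleGraph.Walk.edges_cons, SimpleGraph.Walk.edges_nil,
          ecount_singleton, eq_comm]
        omega

/-- Complete splitting off in an Eulerian multigraph whose edges are walks: all non-terminals can
be eliminated without violating requirements or using any edge more often. -/
theorem exists_complete_splitting [Fintype V] [DecidableEq V] {T : Finset V} {r : V → V → ℕ}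
    (hr : ∀ s t, Even (r s t)) (L : Multiset (BundledWalk G))
    (heven : ∀ X, Even (cutSize (L.map BundledWalk.ends) X))
    (hL : MeetsRequirement T r (L.map BundledWalk.ends)) :
    ∃ L' : Multiset (BundledWalk G),
      (∀ x ∈ L', x.1 ∈ T ∧ x.2.1 ∈ T ∧ x.1 ≠ x.2.1) ∧
      (∀ X, Even (cutSize (L'.map BundledWalk.ends) X)) ∧
      MeetsRequirement T r (L'.map BundledWalk.ends) ∧ ∀ e, load L' e ≤ load L e := by
  induction hn : Multiset.card L using Nat.strong_induction_on generalizing L with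
  | _ n ih =>
    subst hn
    by_cases hloop : ∃ x ∈ L, x.1 = x.2.1
    · obtain ⟨x, hx, hxx⟩ := hloop
      obtain ⟨L₁, rfl⟩ := Multiset.exists_cons_of_mem hx
      have hcut : ∀ X, cutSize ((x ::ₘ L₁).map BundledWalk.ends) X
          = cutSize (L₁.map BundledWalk.ends) X := fun X => by
        simp [BundledWalk.ends, cutIndicator_mk, hxx]
      obtain ⟨L', h1, h2, h3, h4⟩ := ih _ (by simp) L₁ (fun X => hcut X ▸ heven X)
        (fun X s hs t ht hst => hcut X ▸ hL X s hs t ht hst) rfl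
      exact ⟨L', h1, h2, h3, fun e => (h4 e).trans (by simp)⟩
    push Not at hloop
    by_cases hall : ∀ x ∈ L, x.1 ∈ T ∧ x.2.1 ∈ T
    · exact ⟨L, fun x hx => ⟨(hall x hx).1, (hall x hx).2, hloop x hx⟩, heven, hL,
        fun e => le_rfl⟩
    obtain ⟨x, z, u, hx, hxe, hzT, hzu⟩ :
        ∃ (x : BundledWalk G) (z u : V), x ∈ L ∧ x.ends = s(z, u) ∧ z ∉ T ∧ z ≠ u := by
      push Not at hall
      obtain ⟨x, hx, hxT⟩ := hall
      by_cases h1 : x.1 ∈ T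
      · exact ⟨x, x.2.1, x.1, hx, Sym2.eq_swap, hxT h1, (hloop x hx).symm⟩
      · exact ⟨x, x.1, x.2.1, hx, rfl, h1, hloop x hx⟩
    obtain ⟨v, E', hE, hreq⟩ := exists_splitting hr heven hL hzT hzu
      (hxe ▸ Multiset.mem_map_of_mem _ hx)
    obtain ⟨L₁, rfl⟩ := Multiset.exists_cons_of_mem hx
    rw [Multiset.map_cons, hxe, Multiset.cons_inj_right] at hE
    obtain ⟨y, hy, hye⟩ := Multiset.mem_map.1 (hE ▸ Multiset.mem_cons_self _ E')
    obtain ⟨L₂, rfl⟩ := Multiset.exists_cons_of_mem hy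
    rw [Multiset.map_cons, hye, Multiset.cons_inj_right] at hE
    subst hE
    obtain ⟨p, hp⟩ := x.exists_walk hxe
    obtain ⟨q, hq⟩ := y.exists_walk hye
    let w : BundledWalk G := ⟨u, v, p.reverse.append q⟩
    have hw : w.ends = s(u, v) := rfl
    have hwm : ∀ e, w.mult e = x.mult e + y.mult e := fun e => by
      simp only [w, BundledWalk.mult, SimpleGraph.Walk.edges_append,
        SimpleGraph.Walk.edges_reverse, ecount_append, ecount_reverse]
      rw [hp, hq]; rfl
    obtain ⟨L', h1, h2, h3, h4⟩ := ih _ (by simp) (w ::ₘ L₂) (fun X => by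
        have := heven X
        simp only [Multiset.map_cons, hxe, hye, hw, cutSize_cons, cutIndicator_mk] at this ⊢
        rw [Nat.even_iff] at *
        by_cases k1 : z ∈ X <;> by_cases k2 : u ∈ X <;> by_cases k3 : v ∈ X <;>
          simp [k1, k2, k3] at * <;> omega)
      (by rwa [Multiset.map_cons, hw]) rfl
    refine ⟨L', h1, h2, h3, fun e => (h4 e).trans ?_⟩
    simp [hwm, add_assoc]

lemma exists_indexed_walks {s t : V} (L : Multiset (BundledWalk G))
    (hL : ∀ x ∈ L, x.ends = s(s, t)) :
    ∃ n, n = Multiset.card L ∧ ∃ W : Fin n → G.Walk s t,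
      ∀ e, ∑ j, ecount (W j).edges e = load L e := by
  induction L using Multiset.induction_on with
  | empty => exact ⟨0, by simp, Fin.elim0, by simp⟩
  | cons x L ih =>
    obtain ⟨n, hn, W, hW⟩ := ih fun y hy => hL y (Multiset.mem_cons_of_mem hy)
    obtain ⟨p, hp⟩ := x.exists_walk (hL x (Multiset.mem_cons_self x L))
    exact ⟨n + 1, by simp [hn], Fin.cons p W, fun e => by
      simp [Fin.sum_univ_succ, hp, hW]⟩

/-- Menger's theorem for Eulerian multigraphs. -/
lemma exists_edge_disjoint_walks [Fintype V] [DecidableEq V] (F : Multiset (Sym2 V))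
    (hF : ∀ e ∈ F, e ∈ G.edgeSet) (heven : ∀ X, Even (cutSize F X)) {s t : V} {k : ℕ}
    (hk : Even k) (hcut : ∀ X, (s ∈ X ↔ t ∉ X) → k ≤ cutSize F X) (hst : s ≠ t) :
    ∃ n, k ≤ n ∧ ∃ W : Fin n → G.Walk s t, ∀ e, ∑ j, ecount (W j).edges e ≤ F.count e := by
  obtain ⟨L, hLF, hload⟩ := exists_bundledWalks_of_edges F hF
  obtain ⟨L', h1, -, h3, h4⟩ := exists_complete_splitting (T := {s, t}) (r := fun _ _ => k)
    (fun _ _ => hk) L (by rwa [hLF]) (by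
      rw [hLF]
      intro X a ha b hb hab
      apply hcut
      simp only [Finset.mem_insert, Finset.mem_singleton] at ha hb
      rcases ha with rfl | rfl <;> rcases hb with rfl | rfl <;> tauto)
  obtain ⟨n, hn, W, hW⟩ := exists_indexed_walks (s := s) (t := t) L' fun x hx => by
    obtain ⟨h, h', h''⟩ := h1 x hx
    simp only [Finset.mem_insert, Finset.mem_singleton] at h h'
    rw [BundledWalk.ends, Sym2.eq_iff]
    rcases h with h | h <;> rcases h' with h' | h' <;> simp_all
  refine ⟨n, ?_, W, fun e => by rw [hW, ← hload]; exact h4 e⟩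
  calc k ≤ cutSize (L'.map BundledWalk.ends) {s} :=
        h3 {s} s (by simp) t (by simp) (by simp [hst.symm])
    _ ≤ _ := cutSize_le_card _ _
    _ = n := by simp [hn]

variable {S : Finset V} [DecidableEq V]

/-- A walk on the terminals using each edge at most as often as `L` provides it can be realized by
the walks in `L`; the unused walks remain available. -/
lemma exists_realization {a b : {x // x ∈ S}} (Q : (⊤ : SimpleGraph {x // x ∈ S}).Walk a b)
    (L : Multiset (BundledWalk G))
    (hQ : ∀ e, ecount Q.edges e ≤ (L.map BundledWalk.ends).count (e.map Subtype.val)) :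
    ∃ (P : G.Walk (a : V) (b : V)) (L' : Multiset (BundledWalk G)),
      (∀ e, ecount P.edges e + load L' e = load L e) ∧
      ∀ e, ecount Q.edges e + (L'.map BundledWalk.ends).count (e.map Subtype.val)
        = (L.map BundledWalk.ends).count (e.map Subtype.val) := by
  induction Q generalizing L with
  | nil => exact ⟨.nil, L, by simp⟩
  | @cons u v w h Q ih =>
    simp only [SimpleGraph.Walk.edges_cons] at hQ ⊢
    have hmem : s((u : V), (v : V)) ∈ L.map BundledWalk.ends := by
      have := (one_le_ecount (List.mem_cons_self (a := s(u, v)) (l := Q.edges))).trans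
        (hQ s(u, v))
      exact Multiset.one_le_count_iff_mem.1 this
    obtain ⟨x, hx, hxe⟩ := Multiset.mem_map.1 hmem
    obtain ⟨L₁, rfl⟩ := Multiset.exists_cons_of_mem hx
    have hcount : ∀ e : Sym2 {x // x ∈ S},
        ((x ::ₘ L₁).map BundledWalk.ends).count (e.map Subtype.val)
          = ecount [s(u, v)] e + (L₁.map BundledWalk.ends).count (e.map Subtype.val) := fun e => by
      have hinj : e.map Subtype.val = s((u : V), (v : V)) ↔ s(u, v) = e := by
        rw [← Sym2.map_mk, (Sym2.map.injective Subtype.val_injective).eq_iff, eq_comm]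
      rw [Multiset.map_cons, Multiset.count_cons, hxe, ecount_singleton]
      simp only [hinj]
      omega
    simp only [hcount, ecount_cons s(u, v) Q.edges] at hQ ⊢
    obtain ⟨P, L', h1, h2⟩ := ih L₁ fun e => by have := hQ e; omega
    obtain ⟨p, hp⟩ := x.exists_walk hxe
    refine ⟨p.append P, L', fun e => ?_, fun e => ?_⟩
    · rw [SimpleGraph.Walk.edges_append, ecount_append, hp, load_cons, ← h1 e]; omega
    · rw [← h2 e]; omega

lemma exists_realizations (m : ℕ) (a b : Fin m → {x // x ∈ S})
    (Q : ∀ i, (⊤ : SimpleGraph {x // x ∈ S}).Walk (a i) (b i)) (L : Multiset (BundledWalk G))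
    (hQ : ∀ e, ∑ i, ecount (Q i).edges e
      ≤ (L.map BundledWalk.ends).count (e.map Subtype.val)) :
    ∃ P : ∀ i, G.Walk (a i : V) (b i : V), ∀ e, ∑ i, ecount (P i).edges e ≤ load L e := by
  induction m generalizing L with
  | zero => exact ⟨fun i => i.elim0, by simp⟩
  | succ m ih =>
    simp only [Fin.sum_univ_succ] at hQ ⊢
    obtain ⟨P₀, L', h1, h2⟩ := exists_realization (Q 0) L fun e =>
      (Nat.le_add_right _ _).trans (hQ e)
    obtain ⟨P, hP⟩ := ih (fun i => a i.succ) (fun i => b i.succ) (fun i => Q i.succ) L' fun e => by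
      have := hQ e; have := h2 e; omega
    refine ⟨Fin.cons P₀ P, fun e => ?_⟩
    simp only [Fin.cons_zero, Fin.cons_succ]
    have := h1 e; have := hP e; omega

end WalkFamilies

section Flows

variable {V : Type} [DecidableEq V]

/-- Weak duality: the flow between `s` and `t` is at most the size of any cut separating them. -/
lemma flow_le_cutSize [Fintype V] {G : SimpleGraph V} [DecidableRel G.Adj] {m : ℕ}
    {a b : Fin m → V} (P : ∀ i, G.Walk (a i) (b i)) {f : Fin m → ℝ} (hf : ∀ i, 0 ≤ f i)
    (hcap : ∀ e : Sym2 V, ∑ i, (ecount (P i).edges e : ℝ) * f i ≤ 1)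
    {s t : V} {X : Finset V} (hX : s ∈ X ↔ t ∉ X) :
    ∑ i, (if a i = s ∧ b i = t then f i else 0) ≤ cutSize G.edgeFinset.val X := by
  have hcross : ∀ i, a i = s ∧ b i = t →
      1 ≤ ∑ e ∈ G.edgeFinset, cutIndicator X e * ecount (P i).edges e := by
    intro i hi
    obtain ⟨d, hd, hdX⟩ : ∃ d ∈ (P i).darts, cutIndicator X d.edge = 1 := by
      by_cases hs : s ∈ X
      · obtain ⟨d, hd, h1, h2⟩ := (P i).exists_boundary_dart (X : Set V)
          (by simpa [hi.1] using hs) (by simpa [hi.2] using hX.1 hs)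
        refine ⟨d, hd, ?_⟩
        have h1' : d.fst ∈ X := h1
        have h2' : d.snd ∉ X := h2
        change cutIndicator X s(d.fst, d.snd) = 1
        simp [cutIndicator_mk, h1', h2']
      · obtain ⟨d, hd, h1, h2⟩ := (P i).exists_boundary_dart ((X : Set V)ᶜ)
          (by simpa [hi.1] using hs) (by simp [hi.2]; tauto)
        refine ⟨d, hd, ?_⟩
        have h1' : d.fst ∉ X := h1
        have h2' : d.snd ∈ X := by simpa using h2
        change cutIndicator X s(d.fst, d.snd) = 1
        simp [cutIndicator_mk, h1', h2']
    have hmem : d.edge ∈ (P i).edges := List.mem_map_of_mem hd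
    calc 1 ≤ cutIndicator X d.edge * ecount (P i).edges d.edge := by
          rw [hdX, one_mul]; exact one_le_ecount hmem
      _ ≤ _ := Finset.single_le_sum
          (f := fun e => cutIndicator X e * ecount (P i).edges e)
          (fun _ _ => Nat.zero_le _) (by simp)
  calc ∑ i, (if a i = s ∧ b i = t then f i else 0)
      ≤ ∑ i, ∑ e ∈ G.edgeFinset, (cutIndicator X e : ℝ) * ((ecount (P i).edges e : ℝ) * f i) := by
        refine Finset.sum_le_sum fun i _ => ?_
        simp only [← mul_assoc, ← Finset.sum_mul]
        split_ifs with hi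
        · have : (1 : ℝ) ≤ ∑ e ∈ G.edgeFinset, (cutIndicator X e : ℝ) * ecount (P i).edges e := by
            exact_mod_cast hcross i hi
          nlinarith [hf i]
        · have := hf i
          positivity
    _ = ∑ e ∈ G.edgeFinset, (cutIndicator X e : ℝ) * ∑ i, (ecount (P i).edges e : ℝ) * f i := by
        rw [Finset.sum_comm]
        simp only [Finset.mul_sum]
    _ ≤ ∑ e ∈ G.edgeFinset, (cutIndicator X e : ℝ) :=
        Finset.sum_le_sum fun e _ => mul_le_of_le_one_right (by positivity) (hcap e)
    _ = cutSize G.edgeFinset.val X := by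
        unfold cutSize
        exact (Nat.cast_sum G.edgeFinset (cutIndicator X)).symm

/-- If each pair of vertices can be joined by sufficiently many edge-disjoint walks to carry its
demand alone, then all demands together can be routed with congestion the number of pairs. -/
lemma exists_fractional_routing {U : Type} [Fintype U] [DecidableEq U] {H : SimpleGraph U}
    (cap : Sym2 U → ℕ) {m : ℕ} (a b : Fin m → U) {f : Fin m → ℝ} (hf : ∀ i, 0 ≤ f i)
    (hW : ∀ s t, s ≠ t → ∃ (n : ℕ) (W : Fin n → H.Walk s t),
      ∑ i, (if a i = s ∧ b i = t then f i else 0) ≤ n ∧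
      ∀ e, ∑ j, ecount (W j).edges e ≤ cap e) :
    ∃ (m' : ℕ) (d : Fin m' → Fin m) (Q : ∀ j, H.Walk (a (d j)) (b (d j))) (g : Fin m' → ℝ),
      (∀ j, 0 ≤ g j) ∧ (∀ i, (∑ j, if d j = i then g j else 0) = f i) ∧
      ∀ e, ∑ j, (ecount (Q j).edges e : ℝ) * g j ≤ (Fintype.card U : ℝ) ^ 2 * cap e := by
  set D : U → U → ℝ := fun s t => ∑ i, (if a i = s ∧ b i = t then f i else 0) with hD
  have hD0 : ∀ s t, 0 ≤ D s t := fun s t =>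
    Finset.sum_nonneg fun i _ => by split_ifs; exacts [hf i, le_rfl]
  have hfD : ∀ i, f i ≤ D (a i) (b i) := fun i => by
    have := Finset.single_le_sum
      (f := fun k => if a k = a i ∧ b k = b i then f k else 0)
      (fun k _ => by split_ifs; exacts [hf k, le_rfl]) (Finset.mem_univ i)
    simpa using this
  have hW' : ∀ s t, ∃ (n : ℕ) (W : Fin n → H.Walk s t), (n = 0 → D s t = 0 ∧ s ≠ t) ∧
      ∀ e, (∑ j, ecount (W j).edges e : ℝ) / n * D s t ≤ cap e := by
    intro s t
    by_cases hst : s = t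
    · subst hst
      exact ⟨1, fun _ => .nil, by simp, by simp⟩
    · obtain ⟨n, W, hn, hc⟩ := hW s t hst
      refine ⟨n, W, fun h => ⟨le_antisymm (by simpa [h] using hn) (hD0 s t), hst⟩, fun e => ?_⟩
      have h1 : (∑ j, ecount (W j).edges e : ℝ) ≤ cap e := by exact_mod_cast hc e
      have h0 : (0 : ℝ) ≤ ∑ j, (ecount (W j).edges e : ℝ) := by positivity
      refine le_trans ?_ h1
      rw [div_mul_eq_mul_div]
      exact div_le_of_le_mul₀ (by positivity) h0 (mul_le_mul_of_nonneg_left hn h0)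
  choose n W hn hload using hW'
  let ε := Fintype.equivFin (Σ i : Fin m, Fin (n (a i) (b i)))
  refine ⟨_, fun j => (ε.symm j).1, fun j => W _ _ (ε.symm j).2,
    fun j => f (ε.symm j).1 / n (a (ε.symm j).1) (b (ε.symm j).1),
    fun j => div_nonneg (hf _) (by positivity), fun i => ?_, fun e => ?_⟩
  · rw [ε.symm.sum_comp (fun x : Σ i : Fin m, Fin (n (a i) (b i)) =>
      if x.1 = i then f x.1 / n (a x.1) (b x.1) else 0), Fintype.sum_sigma]
    simp only [Finset.sum_const, Finset.card_univ, Fintype.card_fin, nsmul_eq_mul, mul_ite,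
      mul_zero, Finset.sum_ite_eq', Finset.mem_univ, if_true]
    by_cases h : n (a i) (b i) = 0
    · have h1 := (hn _ _ h).1
      have h2 := hfD i
      have h3 := hf i
      simp only [h, Nat.cast_zero, zero_mul]
      linarith
    · field_simp
  · rw [ε.symm.sum_comp (fun x : Σ i : Fin m, Fin (n (a i) (b i)) =>
      (ecount (W _ _ x.2).edges e : ℝ) * (f x.1 / n (a x.1) (b x.1))), Fintype.sum_sigma]
    calc ∑ i, ∑ j, (ecount (W (a i) (b i) j).edges e : ℝ) * (f i / n (a i) (b i))
        = ∑ i, ∑ s, ∑ t, (∑ j, ecount (W s t j).edges e : ℝ) / n s t *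
            (if a i = s ∧ b i = t then f i else 0) := by
          refine Finset.sum_congr rfl fun i _ => ?_
          rw [Finset.sum_eq_single (a i), Finset.sum_eq_single (b i), ← Finset.sum_mul]
          · simp only [and_self, if_true]
            ring
          · intro t _ ht
            simp [ht.symm]
          · simp
          · intro s _ hs
            simp [hs.symm]
          · simp
      _ = ∑ s, ∑ t, (∑ j, ecount (W s t j).edges e : ℝ) / n s t * D s t := by
          rw [Finset.sum_comm]
          refine Finset.sum_congr rfl fun s _ => ?_
          rw [Finset.sum_comm]
          simp only [hD, Finset.mul_sum]
      _ ≤ ∑ _s : U, ∑ _t : U, (cap e : ℝ) :=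
          Finset.sum_le_sum fun s _ => Finset.sum_le_sum fun t _ => hload s t e
      _ = (Fintype.card U : ℝ) ^ 2 * cap e := by
          simp only [Finset.sum_const, Finset.card_univ, nsmul_eq_mul]
          ring

lemma cutSize_map_subtype {S : Finset V} (F : Multiset (Sym2 {x // x ∈ S})) (X : Finset V) :
    cutSize (F.map (Sym2.map Subtype.val)) X = cutSize F (X.subtype (· ∈ S)) := by
  unfold cutSize
  rw [Multiset.map_map]
  congr 1
  refine Multiset.map_congr rfl fun e _ => ?_
  induction e with
  | _ a b => simp [cutIndicator_mk]

end Flows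

/-- **Integer sparsifiers (Theorem `thm:sparsifier`).** For every graph `G = (V,E)`
(with unit capacities) and `S ⊂ V` there is a `(|S|², 2)`-sparsifier for `S` in `G`:
a multigraph `H` on vertex set `S` (given by an edge-multiplicity function `cap` on
pairs from `S`) such that (i) every fractional multicommodity flow in `G` with all path
endpoints in `S` can be fractionally routed in `H` with congestion at most `|S|²`, and
(ii) every integral multicommodity flow in `H` can be integrally routed in `G` with
congestion at most `2`. -/
theorem medp_sparsifier
    (V : Type) [Fintype V] [DecidableEq V] (G : SimpleGraph V) (S : Finset V) :
    ∃ cap : Sym2 {x // x ∈ S} → ℕ,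
      -- (i) fractional flows in G between nodes of S route in H with congestion |S|²
      (∀ (m : ℕ) (a b : Fin m → {x // x ∈ S})
          (P : ∀ i, G.Walk (a i : V) (b i : V)) (f : Fin m → ℝ),
        (∀ i, 0 ≤ f i) →
        (∀ e : Sym2 V, (∑ i, (ecount (P i).edges e : ℝ) * f i) ≤ 1) →
        ∃ (m' : ℕ) (d : Fin m' → Fin m)
          (Q : ∀ j, (⊤ : SimpleGraph {x // x ∈ S}).Walk (a (d j)) (b (d j)))
          (g : Fin m' → ℝ),
          (∀ j, 0 ≤ g j) ∧
          (∀ i, (∑ j, if d j = i then g j else 0) = f i) ∧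
          (∀ e : Sym2 {x // x ∈ S},
            (∑ j, (ecount (Q j).edges e : ℝ) * g j) ≤ (S.card : ℝ) ^ 2 * cap e)) ∧
      -- (ii) integral flows in H route integrally in G with congestion 2
      (∀ (m : ℕ) (a b : Fin m → {x // x ∈ S})
          (Q : ∀ i, (⊤ : SimpleGraph {x // x ∈ S}).Walk (a i) (b i)),
        (∀ e : Sym2 {x // x ∈ S}, (∑ i, ecount (Q i).edges e) ≤ cap e) →
        ∃ P : ∀ i, G.Walk (a i : V) (b i : V),
          ∀ e : Sym2 V, (∑ i, ecount (P i).edges e) ≤ 2) := by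
  classical
  set E := G.edgeFinset.val with hE
  obtain ⟨L, hLE, hLload⟩ := exists_bundledWalks_of_edges (G := G) (E + E) fun e he => by
    simpa [hE] using he
  have heven : ∀ X, Even (cutSize (E + E) X) := fun X => ⟨_, cutSize_add E E X⟩
  set r : V → V → ℕ := fun s t => sInf {n | ∃ X, (s ∈ X ↔ t ∉ X) ∧ cutSize (E + E) X = n} with hr
  have hrmem : ∀ s t, s ≠ t → ∃ X, (s ∈ X ↔ t ∉ X) ∧ cutSize (E + E) X = r s t := fun s t hst =>
    Nat.sInf_mem (s := {n | ∃ X, (s ∈ X ↔ t ∉ X) ∧ cutSize (E + E) X = n})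
      ⟨_, {s}, by simp [hst.symm], rfl⟩
  have hreven : ∀ s t, Even (r s t) := fun s t => by
    by_cases hst : s = t
    · simp [hr, hst]
    · obtain ⟨X, -, hX⟩ := hrmem s t hst
      exact hX ▸ heven X
  obtain ⟨L', hends, heven', hreq, hload⟩ := exists_complete_splitting (T := S) hreven L
    (by rwa [hLE]) (by
      rw [hLE]
      exact fun X s _ t _ hst => Nat.sInf_le ⟨X, hst, rfl⟩)
  obtain ⟨F, hF⟩ : ∃ F : Multiset (Sym2 {x // x ∈ S}),
      F.map (Sym2.map Subtype.val) = L'.map BundledWalk.ends := by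
    refine ⟨L'.attach.map fun x => s(⟨x.1.1, (hends x.1 x.2).1⟩, ⟨x.1.2.1, (hends x.1 x.2).2.1⟩),
      ?_⟩
    rw [Multiset.map_map]
    exact (Multiset.attach_map_val' L' BundledWalk.ends)
  have hcount : ∀ e, F.count e = (L'.map BundledWalk.ends).count (e.map Subtype.val) := fun e => by
    rw [← hF, Multiset.count_map_eq_count' _ _ (Sym2.map.injective Subtype.val_injective)]
  have hcutF : ∀ X : Finset {x // x ∈ S}, cutSize F X
      = cutSize (L'.map BundledWalk.ends) (X.map (Function.Embedding.subtype _)) := fun X => by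
    rw [← hF, cutSize_map_subtype]
    congr 1
    ext x
    simp
  have hFedge : ∀ e ∈ F, e ∈ (⊤ : SimpleGraph {x // x ∈ S}).edgeSet := fun e he => by
    have h := Multiset.mem_map_of_mem (Sym2.map Subtype.val) he
    rw [hF] at h
    obtain ⟨x, hx, hxe⟩ := Multiset.mem_map.1 h
    induction e with
    | _ u v =>
      rw [SimpleGraph.mem_edgeSet, SimpleGraph.top_adj]
      rintro rfl
      refine (hends x hx).2.2 ?_
      rcases Sym2.eq_iff.1 hxe with ⟨h1, h2⟩ | ⟨h1, h2⟩ <;> exact h1.trans h2.symm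
  refine ⟨fun e => F.count e, fun m a b P f hf hcap => ?_, fun m a b Q hQ => ?_⟩
  · have := exists_fractional_routing (H := ⊤) (fun e => F.count e) a b hf fun s t hst => by
      have hst' : (s : V) ≠ t := fun h => hst (Subtype.ext h)
      obtain ⟨n, hn, W, hW⟩ := exists_edge_disjoint_walks (G := ⊤) F hFedge
        (fun X => hcutF X ▸ heven' _) (hreven s t) (fun X hX => by
          rw [hcutF]
          exact hreq _ s s.2 t t.2 (by simpa using hX)) hst
      refine ⟨n, W, ?_, hW⟩
      obtain ⟨X, hX, hXr⟩ := hrmem s t hst'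
      have h1 := flow_le_cutSize P hf hcap hX
      have h2 : cutSize E X ≤ n := by rw [cutSize_add] at hXr; omega
      simp only [← Subtype.ext_iff] at h1
      exact h1.trans (by exact_mod_cast h2)
    simpa only [Fintype.card_coe] using this
  · obtain ⟨P, hP⟩ := exists_realizations m a b Q L' fun e => hcount e ▸ hQ e
    refine ⟨P, fun e => (hP e).trans ((hload e).trans ?_)⟩
    have : E.count e ≤ 1 := Multiset.nodup_iff_count_le_one.1 G.edgeFinset.nodup e
    rw [hLload, Multiset.count_add]
    omega
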